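/- arXiv:2203.02214 — 8 statements merged into one kernel-verified Lean document; each statement's English description precedes it below -/
import Mathlib

section
/- For every policy π, the state-transition occupancy measure satisfies the recursive fixed-point equation: for all states s, s', ρ_π s s' = ρ₀ s * m_π s s' + γ * ∑_{s''} m_π s s' * ρ_π s'' s. -/
/-- Propagating a probability vector through a row-stochastic matrix keeps it a probability
vector at every time. -/
theorem stateVisit_nonneg_and_sum_eq_one {S : Type*} [Fintype S] {m : S → S → ℝ}
    (hm0 : ∀ s s', 0 ≤ m s s') (hm1 : ∀ s, ∑ s', m s s' = 1) {p : ℕ → S → ℝ}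
    (hp0 : ∀ s, 0 ≤ p 0 s) (hp1 : ∑ s, p 0 s = 1)
    (hps : ∀ t s', p (t + 1) s' = ∑ s, p t s * m s s') (t : ℕ) :
    (∀ s, 0 ≤ p t s) ∧ ∑ s, p t s = 1 := by
  induction t with
  | zero => exact ⟨hp0, hp1⟩
  | succ t ih =>
    refine ⟨fun s => ?_, ?_⟩
    · rw [hps]
      exact Finset.sum_nonneg fun i _ => mul_nonneg (ih.1 i) (hm0 i s)
    · simp_rw [hps]
      rw [Finset.sum_comm]
      simp_rw [← Finset.mul_sum, hm1, mul_one]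
      exact ih.2

/-- A geometrically discounted sequence of probability vectors is summable in each coordinate. -/
theorem summable_discounted_of_sum_eq_one {S : Type*} [Fintype S] {γ : ℝ} (hγ0 : 0 ≤ γ)
    (hγ1 : γ < 1) {p : ℕ → S → ℝ} (hp : ∀ t, (∀ s, 0 ≤ p t s) ∧ ∑ s, p t s = 1) (s : S) :
    Summable fun t => γ ^ t * p t s := by
  refine (summable_geometric_of_lt_one hγ0 hγ1).of_nonneg_of_le
    (fun t => mul_nonneg (pow_nonneg hγ0 t) ((hp t).1 s))
    (fun t => mul_le_of_le_one_right (pow_nonneg hγ0 t) ?_)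
  rw [← (hp t).2]
  exact Finset.single_le_sum (fun i _ => (hp t).1 i) (Finset.mem_univ s)

/-- The state-transition occupancy measure satisfies the recursive fixed-point
equation `ρ_π s s' = ρ₀ s * m_π s s' + γ * ∑_{s''} m_π s s' * ρ_π s'' s`. -/
theorem state_transition_om_fixed_point
    {S A : Type*} [Fintype S] [Fintype A] [Nonempty S] [Nonempty A]
    (T : S → A → S → ℝ) (hT0 : ∀ s a s', 0 ≤ T s a s')
    (hT1 : ∀ s a, ∑ s', T s a s' = 1)
    (π : S → A → ℝ) (hπ0 : ∀ s a, 0 ≤ π s a) (hπ1 : ∀ s, ∑ a, π s a = 1)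
    (ρ₀ : S → ℝ) (hρ₀0 : ∀ s, 0 ≤ ρ₀ s) (hρ₀1 : ∑ s, ρ₀ s = 1)
    (γ : ℝ) (hγ0 : 0 ≤ γ) (hγ1 : γ < 1)
    (m : S → S → ℝ) (hm : ∀ s s', m s s' = ∑ a, π s a * T s a s')
    (p : ℕ → S → ℝ) (hp0 : p 0 = ρ₀)
    (hps : ∀ t s', p (t + 1) s' = ∑ s, p t s * m s s')
    (ρ : S → S → ℝ) (hρ : ∀ s s', ρ s s' = ∑' t : ℕ, γ ^ t * p t s * m s s') :
    ∀ s s', ρ s s' = ρ₀ s * m s s' + γ * ∑ s'', m s s' * ρ s'' s := by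
  have hm0 : ∀ s s', 0 ≤ m s s' := fun s s' => by
    rw [hm]
    exact Finset.sum_nonneg fun a _ => mul_nonneg (hπ0 s a) (hT0 s a s')
  have hm1 : ∀ s, ∑ s', m s s' = 1 := fun s => by
    simp_rw [hm]
    rw [Finset.sum_comm]
    simp_rw [← Finset.mul_sum, hT1, mul_one]
    exact hπ1 s
  subst hp0
  have hsum : ∀ s s', Summable fun t => γ ^ t * p t s * m s s' := fun s s' =>
    (summable_discounted_of_sum_eq_one hγ0 hγ1
      (stateVisit_nonneg_and_sum_eq_one hm0 hm1 hρ₀0 hρ₀1 hps) s).mul_right _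
  intro s s'
  rw [hρ, (hsum s s').tsum_eq_zero_add, pow_zero, one_mul]
  congr 1
  simp_rw [hρ]
  rw [← Finset.mul_sum, ← Summable.tsum_finsetSum fun i _ => hsum i s, ← tsum_mul_left,
    ← tsum_mul_left]
  refine tsum_congr fun t => ?_
  simp_rw [hps, mul_assoc, ← Finset.mul_sum]
  ring
end

section
/- For a fixed stochastic matrix m on S, the fixed-point equation of the state-transition occupancy measure has at most one solution: if ρ₁, ρ₂ : S → S → ℝ both satisfy ρ s s' = ρ₀ s * m s s' + γ * ∑_{s''} m s s' * ρ s'' s for all s, s', then ρ₁ = ρ₂. -/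
/-- A real-valued function solving the homogeneous discounted flow equation vanishes. -/
theorem eq_zero_of_discounted_flow {S : Type*} [Fintype S]
    (m : S → S → ℝ) (hm0 : ∀ s s', 0 ≤ m s s') (hm1 : ∀ s, ∑ s', m s s' = 1)
    (γ : ℝ) (hγ0 : 0 ≤ γ) (hγ1 : γ < 1) (d : S → S → ℝ)
    (hd : ∀ s s', d s s' = γ * (m s s' * ∑ s'', d s'' s)) (s s' : S) : d s s' = 0 := by
  have hrow (s : S) : ∑ s', |d s s'| ≤ γ * ∑ s'', |d s'' s| := by
    calc ∑ s', |d s s'| = ∑ s', m s s' * (γ * |∑ s'', d s'' s|) := by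
          refine Finset.sum_congr rfl fun s' _ => ?_
          rw [hd s s', abs_mul, abs_mul, abs_of_nonneg hγ0, abs_of_nonneg (hm0 s s')]
          ring
      _ = γ * |∑ s'', d s'' s| := by rw [← Finset.sum_mul, hm1, one_mul]
      _ ≤ γ * ∑ s'', |d s'' s| :=
          mul_le_mul_of_nonneg_left (Finset.abs_sum_le_sum_abs _ _) hγ0
  have hcontract : ∑ s, ∑ s', |d s s'| ≤ γ * ∑ s, ∑ s', |d s s'| := by
    calc ∑ s, ∑ s', |d s s'| ≤ ∑ s, γ * ∑ s'', |d s'' s| := Finset.sum_le_sum fun s _ => hrow s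
      _ = γ * ∑ s, ∑ s', |d s s'| := by rw [← Finset.mul_sum, Finset.sum_comm]
  have hle : |d s s'| ≤ ∑ s, ∑ s', |d s s'| :=
    (Finset.single_le_sum (f := fun t' => |d s t'|) (fun _ _ => abs_nonneg _)
      (Finset.mem_univ s')).trans
      (Finset.single_le_sum (f := fun t => ∑ t', |d t t'|)
        (fun _ _ => Finset.sum_nonneg fun _ _ => abs_nonneg _) (Finset.mem_univ s))
  exact abs_nonpos_iff.mp (by nlinarith)

/-- The fixed-point equation of the state-transition occupancy measure has at
most one solution. -/
theorem state_transition_om_unique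
    {S : Type*} [Fintype S] [Nonempty S]
    (m : S → S → ℝ) (hm0 : ∀ s s', 0 ≤ m s s') (hm1 : ∀ s, ∑ s', m s s' = 1)
    (ρ₀ : S → ℝ) (hρ₀0 : ∀ s, 0 ≤ ρ₀ s) (hρ₀1 : ∑ s, ρ₀ s = 1)
    (γ : ℝ) (hγ0 : 0 ≤ γ) (hγ1 : γ < 1)
    (ρ₁ ρ₂ : S → S → ℝ)
    (h₁ : ∀ s s', ρ₁ s s' = ρ₀ s * m s s' + γ * ∑ s'', m s s' * ρ₁ s'' s)
    (h₂ : ∀ s s', ρ₂ s s' = ρ₀ s * m s s' + γ * ∑ s'', m s s' * ρ₂ s'' s) :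
    ρ₁ = ρ₂ := by
  funext s s'
  refine sub_eq_zero.mp (eq_zero_of_discounted_flow m hm0 hm1 γ hγ0 hγ1
    (fun s s' => ρ₁ s s' - ρ₂ s s') (fun s s' => ?_) s s')
  rw [h₁ s s', h₂ s s', Finset.sum_sub_distrib, ← Finset.mul_sum, ← Finset.mul_sum]
  ring
end

section
/- For every policy π and every pair of states s, s', the marginal state-transition predictor satisfies m_π s s' * (∑_{s̃} ρ_π s s̃) = ρ_π s s'; in particular, whenever ∑_{s̃} ρ_π s s̃ ≠ 0 one has m_π s s' = ρ_π s s' / ∑_{s̃} ρ_π s s̃. -/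
/-- The marginal state-transition predictor satisfies
`m_π s s' * (∑_{s̃} ρ_π s s̃) = ρ_π s s'`, and hence
`m_π s s' = ρ_π s s' / ∑_{s̃} ρ_π s s̃` when the sum is nonzero. -/
theorem predictor_from_state_transition_om
    {S A : Type*} [Fintype S] [Fintype A] [Nonempty S] [Nonempty A]
    (T : S → A → S → ℝ) (hT0 : ∀ s a s', 0 ≤ T s a s')
    (hT1 : ∀ s a, ∑ s', T s a s' = 1)
    (π : S → A → ℝ) (hπ0 : ∀ s a, 0 ≤ π s a) (hπ1 : ∀ s, ∑ a, π s a = 1)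
    (ρ₀ : S → ℝ) (hρ₀0 : ∀ s, 0 ≤ ρ₀ s) (hρ₀1 : ∑ s, ρ₀ s = 1)
    (γ : ℝ) (hγ0 : 0 ≤ γ) (hγ1 : γ < 1)
    (m : S → S → ℝ) (hm : ∀ s s', m s s' = ∑ a, π s a * T s a s')
    (p : ℕ → S → ℝ) (hp0 : p 0 = ρ₀)
    (hps : ∀ t s', p (t + 1) s' = ∑ s, p t s * m s s')
    (ρ : S → S → ℝ) (hρ : ∀ s s', ρ s s' = ∑' t : ℕ, γ ^ t * p t s * m s s') :
    ∀ s s', m s s' * (∑ st, ρ s st) = ρ s s' ∧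
      ((∑ st, ρ s st) ≠ 0 → m s s' = ρ s s' / ∑ st, ρ s st) := by
  have hm1 (s : S) : ∑ s', m s s' = 1 := by
    simp_rw [hm]
    rw [Finset.sum_comm]
    simp_rw [← Finset.mul_sum, hT1, mul_one, hπ1]
  have hρm (s s' : S) : ρ s s' = (∑' t : ℕ, γ ^ t * p t s) * m s s' := by
    rw [hρ, tsum_mul_right]
  intro s s'
  have key : m s s' * (∑ st, ρ s st) = ρ s s' := by
    simp_rw [hρm, ← Finset.mul_sum, hm1, mul_one]
    exact mul_comm _ _
  exact ⟨key, fun h => (eq_div_iff h).2 key⟩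
end

section
/- Suppose the transition kernel T has a redundant action: there exist a state s_m, an action a_n, and p : A → ℝ with p a ≥ 0 for all a, p a_n = 0, ∑_{a} p a = 1, and ∑_{a} p a * T s_m a s' = T s_m a_n s' for all s'. Let π₀ be any policy with π₀ s_m a_n = 1 and π₀ s_m a = 0 for a ≠ a_n, and define π₁ by π₁ s := π₀ s for s ≠ s_m and π₁ s_m := p. Then π₀ ≠ π₁, yet their marginal state-transition predictors coincide, m_{π₀} = m_{π₁}, and consequently their state-transition occupancy measures coincide, ρ_{π₀} = ρ_{π₁}. -/
/-- Under a redundant action, two different policies `π₀ ≠ π₁` share the same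
marginal state-transition predictor and hence the same state-transition
occupancy measure. -/
theorem redundant_action_same_om
    {S A : Type*} [Fintype S] [Fintype A] [Nonempty S] [Nonempty A]
    [DecidableEq S] [DecidableEq A]
    (T : S → A → S → ℝ) (hT0 : ∀ s a s', 0 ≤ T s a s')
    (hT1 : ∀ s a, ∑ s', T s a s' = 1)
    (ρ₀ : S → ℝ) (hρ₀0 : ∀ s, 0 ≤ ρ₀ s) (hρ₀1 : ∑ s, ρ₀ s = 1)
    (γ : ℝ) (hγ0 : 0 ≤ γ) (hγ1 : γ < 1)
    -- redundant action
    (sm : S) (an : A) (p : A → ℝ)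
    (hp0 : ∀ a, 0 ≤ p a) (hpan : p an = 0) (hp1 : ∑ a, p a = 1)
    (hred : ∀ s', ∑ a, p a * T sm a s' = T sm an s')
    -- the two policies
    (π₀ π₁ : S → A → ℝ)
    (hπ₀0 : ∀ s a, 0 ≤ π₀ s a) (hπ₀1 : ∀ s, ∑ a, π₀ s a = 1)
    (hπ₁0 : ∀ s a, 0 ≤ π₁ s a) (hπ₁1 : ∀ s, ∑ a, π₁ s a = 1)
    (hπ₀an : π₀ sm an = 1) (hπ₀a : ∀ a, a ≠ an → π₀ sm a = 0)
    (hπ₁ : ∀ s, s ≠ sm → π₁ s = π₀ s) (hπ₁sm : π₁ sm = p)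
    -- predictors
    (m₀ m₁ : S → S → ℝ)
    (hm₀ : ∀ s s', m₀ s s' = ∑ a, π₀ s a * T s a s')
    (hm₁ : ∀ s s', m₁ s s' = ∑ a, π₁ s a * T s a s')
    -- state-visit sequences
    (q₀ q₁ : ℕ → S → ℝ)
    (hq₀0 : q₀ 0 = ρ₀) (hq₀s : ∀ t s', q₀ (t + 1) s' = ∑ s, q₀ t s * m₀ s s')
    (hq₁0 : q₁ 0 = ρ₀) (hq₁s : ∀ t s', q₁ (t + 1) s' = ∑ s, q₁ t s * m₁ s s')
    -- occupancy measures
    (ρ₀om ρ₁om : S → S → ℝ)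
    (hρ₀om : ∀ s s', ρ₀om s s' = ∑' t : ℕ, γ ^ t * q₀ t s * m₀ s s')
    (hρ₁om : ∀ s s', ρ₁om s s' = ∑' t : ℕ, γ ^ t * q₁ t s * m₁ s s') :
    π₀ ≠ π₁ ∧ m₀ = m₁ ∧ ρ₀om = ρ₁om := by
  have hm : m₀ = m₁ := by
    funext s s'
    rw [hm₀, hm₁]
    by_cases hs : s = sm
    · subst hs
      rw [hπ₁sm, hred, Finset.sum_eq_single an (fun a _ ha => by rw [hπ₀a a ha, zero_mul])
        (fun h => absurd (Finset.mem_univ an) h), hπ₀an, one_mul]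
    · rw [hπ₁ s hs]
  have hq : ∀ t, q₀ t = q₁ t := by
    intro t
    induction t with
    | zero => rw [hq₀0, hq₁0]
    | succ t ih =>
      funext s'
      rw [hq₀s, hq₁s, ih, hm]
  refine ⟨fun h => ?_, hm, ?_⟩
  · rw [h, hπ₁sm, hpan] at hπ₀an
    exact zero_ne_one hπ₀an
  · funext s s'
    simp only [hρ₀om, hρ₁om, hq, hm]
end

section
/- The state-transition occupancy measure determines the state-transition predictor: let h₁ and h₂ be stochastic matrices on S, and for i ∈ {1,2} define the state-visit sequences p^{(i)}_0 := ρ₀, p^{(i)}_{t+1} s' := ∑_{s} p^{(i)}_t s * h_i s s', and occupancy measures ρ^{(i)} s s' := ∑_{t=0}^∞ γ^t * p^{(i)}_t s * h_i s s'. If ρ₀ s > 0 for every state s and ρ^{(1)} = ρ^{(2)}, then h₁ = h₂. -/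
/-- The state-visit sequence of a nonnegative kernel stays nonnegative. -/
lemma visit_nonneg {S : Type*} [Fintype S] {h : S → S → ℝ} {p : ℕ → S → ℝ}
    (hh0 : ∀ s s', 0 ≤ h s s') (hp0 : ∀ s, 0 ≤ p 0 s)
    (hps : ∀ t s', p (t + 1) s' = ∑ s, p t s * h s s') (t : ℕ) (s : S) : 0 ≤ p t s := by
  induction t generalizing s with
  | zero => exact hp0 s
  | succ t ih =>
    rw [hps]
    exact Finset.sum_nonneg fun s' _ => mul_nonneg (ih s') (hh0 s' s)

/-- The total mass of the state-visit sequence of a stochastic matrix is conserved. -/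
lemma sum_visit {S : Type*} [Fintype S] {h : S → S → ℝ} {p : ℕ → S → ℝ}
    (hh1 : ∀ s, ∑ s', h s s' = 1)
    (hps : ∀ t s', p (t + 1) s' = ∑ s, p t s * h s s') (t : ℕ) :
    ∑ s, p t s = ∑ s, p 0 s := by
  induction t with
  | zero => rfl
  | succ t ih =>
    simp_rw [hps, ← ih]
    rw [Finset.sum_comm]
    simp_rw [← Finset.mul_sum, hh1, mul_one]

/-- The discounted visit measure of a state is positive if its initial probability is. -/
lemma tsum_discounted_visit_pos {S : Type*} [Fintype S] {h : S → S → ℝ} {p : ℕ → S → ℝ}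
    (hh0 : ∀ s s', 0 ≤ h s s') (hh1 : ∀ s, ∑ s', h s s' = 1) (hp0 : ∀ s, 0 ≤ p 0 s)
    (hps : ∀ t s', p (t + 1) s' = ∑ s, p t s * h s s')
    {γ : ℝ} (hγ0 : 0 ≤ γ) (hγ1 : γ < 1) {s : S} (hs : 0 < p 0 s) :
    0 < ∑' t : ℕ, γ ^ t * p t s := by
  have hnn := visit_nonneg hh0 hp0 hps
  have hterm (t : ℕ) : 0 ≤ γ ^ t * p t s := mul_nonneg (pow_nonneg hγ0 t) (hnn t s)
  have hle (t : ℕ) : γ ^ t * p t s ≤ γ ^ t * ∑ s, p 0 s := by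
    gcongr
    rw [← sum_visit hh1 hps t]
    exact Finset.single_le_sum (fun s _ => hnn t s) (Finset.mem_univ s)
  have hsum : Summable fun t : ℕ => γ ^ t * p t s :=
    .of_nonneg_of_le hterm hle ((summable_geometric_of_lt_one hγ0 hγ1).mul_right _)
  exact hsum.tsum_pos hterm 0 (by simpa using hs)

/-- The state-transition occupancy measure determines the state-transition
predictor: if two stochastic matrices induce the same occupancy measure from a
fully supported initial distribution, they coincide. -/
theorem om_determines_predictor
    {S : Type*} [Fintype S] [Nonempty S]
    (h₁ h₂ : S → S → ℝ)
    (hh₁0 : ∀ s s', 0 ≤ h₁ s s') (hh₁1 : ∀ s, ∑ s', h₁ s s' = 1)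
    (hh₂0 : ∀ s s', 0 ≤ h₂ s s') (hh₂1 : ∀ s, ∑ s', h₂ s s' = 1)
    (ρ₀ : S → ℝ) (hρ₀0 : ∀ s, 0 ≤ ρ₀ s) (hρ₀1 : ∑ s, ρ₀ s = 1)
    (γ : ℝ) (hγ0 : 0 ≤ γ) (hγ1 : γ < 1)
    (p₁ p₂ : ℕ → S → ℝ)
    (hp₁0 : p₁ 0 = ρ₀) (hp₁s : ∀ t s', p₁ (t + 1) s' = ∑ s, p₁ t s * h₁ s s')
    (hp₂0 : p₂ 0 = ρ₀) (hp₂s : ∀ t s', p₂ (t + 1) s' = ∑ s, p₂ t s * h₂ s s')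
    (ρA ρB : S → S → ℝ)
    (hρA : ∀ s s', ρA s s' = ∑' t : ℕ, γ ^ t * p₁ t s * h₁ s s')
    (hρB : ∀ s s', ρB s s' = ∑' t : ℕ, γ ^ t * p₂ t s * h₂ s s')
    (hpos : ∀ s, 0 < ρ₀ s) (heq : ρA = ρB) :
    h₁ = h₂ := by
  have hpos₁ (s : S) : 0 < ∑' t : ℕ, γ ^ t * p₁ t s :=
    tsum_discounted_visit_pos hh₁0 hh₁1 (hp₁0 ▸ hρ₀0) hp₁s hγ0 hγ1 (hp₁0 ▸ hpos s)
  have hmul (s s' : S) : (∑' t : ℕ, γ ^ t * p₁ t s) * h₁ s s' =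
      (∑' t : ℕ, γ ^ t * p₂ t s) * h₂ s s' := by
    rw [← tsum_mul_right, ← tsum_mul_right, ← hρA, ← hρB, heq]
  have hvisit (s : S) : ∑' t : ℕ, γ ^ t * p₁ t s = ∑' t : ℕ, γ ^ t * p₂ t s := by
    simpa only [← Finset.mul_sum, hh₁1, hh₂1, mul_one] using
      Finset.sum_congr (rfl : Finset.univ = Finset.univ) fun s' _ => hmul s s'
  ext s s'
  exact mul_left_cancel₀ (hpos₁ s).ne' ((hmul s s').trans (by rw [hvisit]))
end

section
/- Decoupling identity for stochastic dynamics: for every policy π, define the state planner h_π s' s := ρ_π s s' / ρ_π s and the inverse dynamics I_π a s s' := π s a * T s a s' * ρ_π s / ρ_π s s' when ρ_π s s' > 0, and I_π a s s' := 0 otherwise. Then for every state s with ρ_π s > 0 and every action a, the policy decouples as π s a = ∑_{s'} h_π s' s * I_π a s s'. -/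
/-- Decoupling identity for stochastic dynamics: with state planner
`h_π s' s = ρ_π s s' / ρ_π s` and inverse dynamics
`I_π a s s' = π s a * T s a s' * ρ_π s / ρ_π s s'` (and `0` when
`ρ_π s s' ≤ 0`), the policy decouples as
`π s a = ∑_{s'} h_π s' s * I_π a s s'` whenever `ρ_π s > 0`. -/
theorem decoupling_identity_stochastic
    {S A : Type*} [Fintype S] [Fintype A] [Nonempty S] [Nonempty A]
    (T : S → A → S → ℝ) (hT0 : ∀ s a s', 0 ≤ T s a s')
    (hT1 : ∀ s a, ∑ s', T s a s' = 1)
    (π : S → A → ℝ) (hπ0 : ∀ s a, 0 ≤ π s a) (hπ1 : ∀ s, ∑ a, π s a = 1)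
    (ρ₀ : S → ℝ) (hρ₀0 : ∀ s, 0 ≤ ρ₀ s) (hρ₀1 : ∑ s, ρ₀ s = 1)
    (γ : ℝ) (hγ0 : 0 ≤ γ) (hγ1 : γ < 1)
    (m : S → S → ℝ) (hm : ∀ s s', m s s' = ∑ a, π s a * T s a s')
    (p : ℕ → S → ℝ) (hp0 : p 0 = ρ₀)
    (hps : ∀ t s', p (t + 1) s' = ∑ s, p t s * m s s')
    (ρst : S → S → ℝ)
    (hρst : ∀ s s', ρst s s' = ∑' t : ℕ, γ ^ t * p t s * m s s')
    (ρs : S → ℝ) (hρs : ∀ s, ρs s = ∑' t : ℕ, γ ^ t * p t s)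
    (h : S → S → ℝ) (hh : ∀ s s', h s' s = ρst s s' / ρs s)
    (I : A → S → S → ℝ)
    (hI : ∀ a s s', I a s s' =
      if 0 < ρst s s' then π s a * T s a s' * ρs s / ρst s s' else 0) :
    ∀ s, 0 < ρs s → ∀ a, π s a = ∑ s', h s' s * I a s s' := by
  intro s hs a
  have factor : ∀ s', ρst s s' = ρs s * m s s' := fun s' => by
    rw [hρst, hρs, tsum_mul_right]
  have term : ∀ s', h s' s * I a s s' = π s a * T s a s' := fun s' => by
    rw [hh, hI]
    split_ifs with hpos
    · field_simp
    · have hle : π s a * T s a s' ≤ m s s' := by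
        rw [hm]
        exact Finset.single_le_sum (f := fun b => π s b * T s b s')
          (fun b _ => mul_nonneg (hπ0 s b) (hT0 s b s')) (Finset.mem_univ a)
      have hm0 : m s s' ≤ 0 := by
        by_contra! hlt
        exact hpos (factor s' ▸ mul_pos hs hlt)
      linarith [mul_nonneg (hπ0 s a) (hT0 s a s')]
  simp_rw [term, ← Finset.mul_sum, hT1, mul_one]
end

section
/- Decoupling identity for deterministic dynamics: suppose the transition kernel is deterministic, i.e. T s a s' = 1 if s' = f s a and 0 otherwise, for a function f : S → A → S. With h_π s' s := ρ_π s s' / ρ_π s and I_π a s s' := π s a * T s a s' * ρ_π s / ρ_π s s' when ρ_π s s' > 0 and I_π a s s' := 0 otherwise, it holds that for every state s with ρ_π s > 0 and every action a, the policy factors as a single product: π s a = h_π (f s a) s * I_π a s (f s a). -/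
/-- Decoupling identity for deterministic dynamics: if `T` is the deterministic
kernel of `f : S → A → S`, then `π s a = h_π (f s a) s * I_π a s (f s a)`
whenever `ρ_π s > 0`. -/
theorem decoupling_identity_deterministic
    {S A : Type*} [Fintype S] [Fintype A] [Nonempty S] [Nonempty A]
    [DecidableEq S]
    (T : S → A → S → ℝ) (hT0 : ∀ s a s', 0 ≤ T s a s')
    (hT1 : ∀ s a, ∑ s', T s a s' = 1)
    (f : S → A → S)
    (hdet : ∀ s a s', T s a s' = if s' = f s a then (1 : ℝ) else 0)
    (π : S → A → ℝ) (hπ0 : ∀ s a, 0 ≤ π s a) (hπ1 : ∀ s, ∑ a, π s a = 1)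
    (ρ₀ : S → ℝ) (hρ₀0 : ∀ s, 0 ≤ ρ₀ s) (hρ₀1 : ∑ s, ρ₀ s = 1)
    (γ : ℝ) (hγ0 : 0 ≤ γ) (hγ1 : γ < 1)
    (m : S → S → ℝ) (hm : ∀ s s', m s s' = ∑ a, π s a * T s a s')
    (p : ℕ → S → ℝ) (hp0 : p 0 = ρ₀)
    (hps : ∀ t s', p (t + 1) s' = ∑ s, p t s * m s s')
    (ρst : S → S → ℝ)
    (hρst : ∀ s s', ρst s s' = ∑' t : ℕ, γ ^ t * p t s * m s s')
    (ρs : S → ℝ) (hρs : ∀ s, ρs s = ∑' t : ℕ, γ ^ t * p t s)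
    (h : S → S → ℝ) (hh : ∀ s s', h s' s = ρst s s' / ρs s)
    (I : A → S → S → ℝ)
    (hI : ∀ a s s', I a s s' =
      if 0 < ρst s s' then π s a * T s a s' * ρs s / ρst s s' else 0) :
    ∀ s, 0 < ρs s → ∀ a, π s a = h (f s a) s * I a s (f s a) := by
  intro s hs a
  have hfac : ρst s (f s a) = ρs s * m s (f s a) := by
    rw [hρst, hρs, tsum_mul_right]
  have hTa : T s a (f s a) = 1 := by rw [hdet, if_pos rfl]
  have hle : π s a ≤ m s (f s a) := by
    rw [hm]
    simpa [hTa] using Finset.single_le_sum (f := fun b => π s b * T s b (f s a))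
      (fun b _ => mul_nonneg (hπ0 s b) (hT0 s b _)) (Finset.mem_univ a)
  rw [hh, hI, hTa]
  split_ifs with hpos
  · field_simp
  · have hm_le : m s (f s a) ≤ 0 := by
      by_contra! hm_pos
      exact hpos (hfac ▸ mul_pos hs hm_pos)
    rw [mul_zero]
    exact le_antisymm (hle.trans hm_le) (hπ0 s a)
end

section
/- Optimality is preserved under same-successor action replacement (Theorem 1): let f : S → A → S be deterministic dynamics, r : S → S → ℝ a state-only reward, ŝ a state, s₀ a state, and 𝒜(ŝ) := {a | f ŝ a = s₀}. Let π* and π be policies with π* ŝ a = 0 and π ŝ a = 0 for every a ∉ 𝒜(ŝ), and π s = π* s for every s ≠ ŝ. If V* : S → ℝ satisfies the Bellman equation for π*, i.e. V* s = ∑_{a} π* s a * (r s (f s a) + γ * V* (f s a)) for all s, and V : S → ℝ satisfies the Bellman equation for π, i.e. V s = ∑_{a} π s a * (r s (f s a) + γ * V (f s a)) for all s, then V = V*; i.e. replacing the action distribution at ŝ by any distribution over 𝒜(ŝ) leaves the value function unchanged, so it does not affect optimality. -/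
/-- Averaging a function of `f a` against weights of total mass one that are supported on
`{a | f a = x}` yields its value at `x`. -/
theorem sum_mul_comp_eq_of_support {S A : Type*} [Fintype A] {p : A → ℝ} {f : A → S} {x : S}
    (hp : ∑ a, p a = 1) (hsupp : ∀ a, f a ≠ x → p a = 0) (g : S → ℝ) :
    ∑ a, p a * g (f a) = g x := by
  have h : ∀ a, p a * g (f a) = p a * g x := by
    intro a
    by_cases ha : f a = x
    · rw [ha]
    · simp [hsupp a ha]
  simp_rw [h, ← Finset.sum_mul, hp, one_mul]

/-- The Bellman equation of a policy on a finite state space with discount factor in `[0, 1)`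
has at most one solution. -/
theorem bellman_solution_unique {S A : Type*} [Fintype S] [Fintype A] {f : S → A → S}
    {r : S → S → ℝ} {γ : ℝ} (hγ0 : 0 ≤ γ) (hγ1 : γ < 1) {π : S → A → ℝ}
    (hπ0 : ∀ s a, 0 ≤ π s a) (hπ1 : ∀ s, ∑ a, π s a = 1) {V W : S → ℝ}
    (hV : ∀ s, V s = ∑ a, π s a * (r s (f s a) + γ * V (f s a)))
    (hW : ∀ s, W s = ∑ a, π s a * (r s (f s a) + γ * W (f s a))) : V = W := by
  funext s
  have : Nonempty S := ⟨s⟩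
  obtain ⟨m, hm⟩ := Finite.exists_max fun s => |V s - W s|
  have hle : |V m - W m| ≤ γ * |V m - W m| := calc
    |V m - W m| = |∑ a, π m a * (γ * (V (f m a) - W (f m a)))| := by
      rw [hV m, hW m, ← Finset.sum_sub_distrib]
      congr 1
      exact Finset.sum_congr rfl fun a _ => by ring
    _ ≤ ∑ a, |π m a * (γ * (V (f m a) - W (f m a)))| := Finset.abs_sum_le_sum_abs _ _
    _ ≤ ∑ a, π m a * (γ * |V m - W m|) := by
      refine Finset.sum_le_sum fun a _ => ?_
      rw [abs_mul, abs_mul, abs_of_nonneg (hπ0 m a), abs_of_nonneg hγ0]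
      exact mul_le_mul_of_nonneg_left (mul_le_mul_of_nonneg_left (hm _) hγ0) (hπ0 m a)
    _ = γ * |V m - W m| := by rw [← Finset.sum_mul, hπ1, one_mul]
  have hs : |V s - W s| ≤ 0 := (hm s).trans (by nlinarith [abs_nonneg (V m - W m)])
  exact sub_eq_zero.mp (abs_nonpos_iff.mp hs)

/-- Optimality is preserved under same-successor action replacement
(Theorem 1): replacing the action distribution at `ŝ` by any distribution
over `𝒜(ŝ) = {a | f ŝ a = s₀}` leaves the value function unchanged. -/
theorem same_successor_replacement_preserves_value
    {S A : Type*} [Fintype S] [Fintype A] [Nonempty S] [Nonempty A]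
    (f : S → A → S) (r : S → S → ℝ)
    (γ : ℝ) (hγ0 : 0 ≤ γ) (hγ1 : γ < 1)
    (shat s₀ : S)
    (πstar π : S → A → ℝ)
    (hπstar0 : ∀ s a, 0 ≤ πstar s a) (hπstar1 : ∀ s, ∑ a, πstar s a = 1)
    (hπ0 : ∀ s a, 0 ≤ π s a) (hπ1 : ∀ s, ∑ a, π s a = 1)
    (hsuppstar : ∀ a, f shat a ≠ s₀ → πstar shat a = 0)
    (hsupp : ∀ a, f shat a ≠ s₀ → π shat a = 0)
    (hagree : ∀ s, s ≠ shat → π s = πstar s)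
    (Vstar V : S → ℝ)
    (hVstar : ∀ s, Vstar s = ∑ a, πstar s a * (r s (f s a) + γ * Vstar (f s a)))
    (hV : ∀ s, V s = ∑ a, π s a * (r s (f s a) + γ * V (f s a))) :
    V = Vstar := by
  refine bellman_solution_unique hγ0 hγ1 hπstar0 hπstar1 (fun s => ?_) hVstar
  rw [hV s]
  by_cases hs : s = shat
  · subst hs
    let g : S → ℝ := fun t => r s t + γ * V t
    exact (sum_mul_comp_eq_of_support (hπ1 s) hsupp g).trans
      (sum_mul_comp_eq_of_support (hπstar1 s) hsuppstar g).symm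
  · rw [hagree s hs]
end
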